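/- Let M = (S, A, s_init, H, T, R) be a finite episodic MDP with rewards R_h(s,a) ∈ [0,1]. Let ρ : {1,…,H}×S → A be an abstract policy and let π be any history-dependent policy, i.e., a collection of maps π_h : S^h → A choosing the action at step h from the state history (s_1,…,s_h). Then V^ρ_M − V^π_M ≤ H · E_{M,π}[ Σ_{h=1}^H 1{a_h ≠ ρ_h(s_h)} ], where the expectation is over trajectories generated by s_1 = s_init, a_h = π_h(s_1,…,s_h), s_{h+1} ~ T_h(·|s_h,a_h), and V^π_M = E_{M,π}[Σ_{h=1}^H R_h(s_h,a_h)] is the value of π. -/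

import Mathlib

/-- A finite episodic MDP: finite state space `S`, finite action space `A`,
initial state, horizon `H`, step-indexed transition probabilities and rewards
(steps are indexed `1, …, H`). -/
structure FinMDP (S A : Type) [Fintype S] [Fintype A] where
  H : ℕ
  init : S
  T : ℕ → S → A → S → ℝ
  R : ℕ → S → A → ℝ
  T_nonneg : ∀ h s a s', 0 ≤ T h s a s'
  T_sum : ∀ h s a, ∑ s', T h s a s' = 1
  R_nonneg : ∀ h s a, 0 ≤ R h s a
  R_le_one : ∀ h s a, R h s a ≤ 1

/-- Auxiliary backward recursion: `valAux M ψ k` is the value function with `k`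
steps remaining, i.e. at step `h = M.H + 1 - k`. -/
noncomputable def valAux {S A : Type} [Fintype S] [Fintype A]
    (M : FinMDP S A) (ψ : ℕ → S → A) : ℕ → S → ℝ
  | 0, _ => 0
  | k + 1, s =>
      M.R (M.H - k) s (ψ (M.H - k) s)
        + ∑ s', M.T (M.H - k) s (ψ (M.H - k) s) s' * valAux M ψ k s'

/-- `val M ψ h s` is the value function `V^ψ_{M,h}(s)` of the abstract policy `ψ`:
`V^ψ_{M,H+1} = 0` and `V^ψ_{M,h}(s) = R_h(s,ψ_h(s)) + ∑ s', T_h(s'|s,ψ_h(s)) V^ψ_{M,h+1}(s')`. -/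
noncomputable def val {S A : Type} [Fintype S] [Fintype A]
    (M : FinMDP S A) (ψ : ℕ → S → A) (h : ℕ) (s : S) : ℝ :=
  valAux M ψ (M.H + 1 - h) s

/-- `M'` is an η-perturbation of `M`: same horizon and initial state, and there is a
noise kernel `ξ` with `ξ_h(a|s,a) ≥ 1-η` realizing `M'`'s transitions and rewards as
action-perturbed versions of `M`'s on every step `h ∈ {1,…,H}`. -/
def IsPerturbation {S A : Type} [Fintype S] [Fintype A] (η : ℝ)
    (M M' : FinMDP S A) : Prop :=
  M'.H = M.H ∧ M'.init = M.init ∧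
  ∃ ξ : ℕ → S → A → A → ℝ,
    ∀ h ∈ Finset.Icc 1 M.H, ∀ (s : S) (a : A),
      (∀ a', 0 ≤ ξ h s a a') ∧ (∑ a', ξ h s a a') = 1 ∧ 1 - η ≤ ξ h s a a ∧
      (∀ s', M'.T h s a s' = ∑ a', M.T h s a' s' * ξ h s a a') ∧
      M'.R h s a = ∑ a', M.R h s a' * ξ h s a a'

/-- Extend a finite state sequence `τ : Fin (H+1) → S` (positions `0,…,H` holding
`s_1,…,s_{H+1}`) to a function on `ℕ`. -/
def extSeq {S : Type} (H : ℕ) (τ : Fin (H + 1) → S) : ℕ → S :=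
  fun n => if hn : n < H + 1 then τ ⟨n, hn⟩ else τ ⟨0, Nat.succ_pos H⟩

/-- The probability of the state trajectory `τ` (with `τ i = s_{i+1}`) under the
history-dependent policy `π` in the MDP `M`: the trajectory starts at `M.init` and each
transition at step `h = i+1` uses the action `π (i+1)` chosen from the state history. -/
noncomputable def trajWeight {S A : Type} [Fintype S] [Fintype A] [DecidableEq S]
    (M : FinMDP S A) (π : ℕ → (ℕ → S) → A) (τ : Fin (M.H + 1) → S) : ℝ :=
  (if τ ⟨0, Nat.succ_pos M.H⟩ = M.init then (1 : ℝ) else 0) *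
    ∏ i ∈ Finset.range M.H,
      M.T (i + 1) (extSeq M.H τ i) (π (i + 1) (extSeq M.H τ)) (extSeq M.H τ (i + 1))

theorem valAux_nonneg {S A : Type} [Fintype S] [Fintype A]
    (M : FinMDP S A) (ψ : ℕ → S → A) (k : ℕ) : ∀ s, 0 ≤ valAux M ψ k s := by
  induction k with
  | zero => intro s; simp [valAux]
  | succ k ih =>
    intro s
    rw [valAux]
    exact add_nonneg (M.R_nonneg _ _ _)
      (Finset.sum_nonneg fun s' _ => mul_nonneg (M.T_nonneg _ _ _ _) (ih s'))

theorem valAux_le {S A : Type} [Fintype S] [Fintype A]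
    (M : FinMDP S A) (ψ : ℕ → S → A) (k : ℕ) : ∀ s, valAux M ψ k s ≤ k := by
  induction k with
  | zero => intro s; simp [valAux]
  | succ k ih =>
    intro s
    rw [valAux]
    have h1 := M.R_le_one (M.H - k) s (ψ (M.H - k) s)
    have h2 : ∑ s', M.T (M.H - k) s (ψ (M.H - k) s) s' * valAux M ψ k s'
        ≤ ∑ s', M.T (M.H - k) s (ψ (M.H - k) s) s' * (k : ℝ) :=
      Finset.sum_le_sum fun s' _ => mul_le_mul_of_nonneg_left (ih s') (M.T_nonneg _ _ _ _)
    rw [← Finset.sum_mul, M.T_sum, one_mul] at h2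
    push_cast
    linarith

/-- One-step inequality. -/
theorem val_step {S A : Type} [Fintype S] [Fintype A] [DecidableEq A]
    (M : FinMDP S A) (ρ : ℕ → S → A) (n : ℕ) (hn : n < M.H) (s : S) (a : A) :
    val M ρ (n + 1) s ≤ M.R (n + 1) s a + (M.H : ℝ) * (if a ≠ ρ (n + 1) s then (1 : ℝ) else 0)
      + ∑ s', M.T (n + 1) s a s' * val M ρ (n + 1 + 1) s' := by
  by_cases h : a = ρ (n + 1) s
  · subst h
    unfold val
    obtain ⟨k, hk⟩ : ∃ k, M.H = n + 1 + k := ⟨M.H - (n + 1), by omega⟩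
    have e1 : M.H + 1 - (n + 1) = k + 1 := by omega
    have e2 : M.H + 1 - (n + 1 + 1) = k := by omega
    have e3 : M.H - k = n + 1 := by omega
    rw [e1, e2, valAux, e3]
    simp
  · have h1 : val M ρ (n + 1) s ≤ M.H := by
      refine (valAux_le M ρ _ s).trans ?_
      exact_mod_cast (by omega : M.H + 1 - (n + 1) ≤ M.H)
    have h2 := M.R_nonneg (n + 1) s a
    have h3 : 0 ≤ ∑ s', M.T (n + 1) s a s' * val M ρ (n + 1 + 1) s' :=
      Finset.sum_nonneg fun s' _ => mul_nonneg (M.T_nonneg _ _ _ _) (valAux_nonneg M ρ _ s')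
    rw [if_pos h]
    linarith

/-- Weight of a trajectory prefix. -/
noncomputable def prefWeight {S A : Type} [Fintype S] [Fintype A] [DecidableEq S]
    (M : FinMDP S A) (π : ℕ → (ℕ → S) → A) (n : ℕ) (τ : Fin (n + 1) → S) : ℝ :=
  (if τ ⟨0, Nat.succ_pos n⟩ = M.init then (1 : ℝ) else 0) *
    ∏ i ∈ Finset.range n,
      M.T (i + 1) (extSeq n τ i) (π (i + 1) (extSeq n τ)) (extSeq n τ (i + 1))

theorem prefWeight_nonneg {S A : Type} [Fintype S] [Fintype A] [DecidableEq S]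
    (M : FinMDP S A) (π : ℕ → (ℕ → S) → A) (n : ℕ) (τ : Fin (n + 1) → S) :
    0 ≤ prefWeight M π n τ := by
  unfold prefWeight
  refine mul_nonneg ?_ (Finset.prod_nonneg fun i _ => M.T_nonneg _ _ _ _)
  split_ifs <;> norm_num

theorem extSeq_snoc_of_le {S : Type} (n : ℕ) (τ : Fin (n + 1) → S) (s : S) (i : ℕ)
    (hi : i < n + 1) :
    extSeq (n + 1) (Fin.snoc (α := fun _ => S) τ s) i = extSeq n τ i := by
  have h : i < n + 1 + 1 := by omega
  simp [extSeq, h, hi, Fin.snoc, Fin.castLT]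

theorem extSeq_snoc_last {S : Type} (n : ℕ) (τ : Fin (n + 1) → S) (s : S) :
    extSeq (n + 1) (Fin.snoc (α := fun _ => S) τ s) (n + 1) = s := by
  simp [extSeq, Fin.snoc]

theorem prefWeight_snoc {S A : Type} [Fintype S] [Fintype A] [DecidableEq S]
    (M : FinMDP S A) (π : ℕ → (ℕ → S) → A)
    (hπ : ∀ (h : ℕ) (σ σ' : ℕ → S), (∀ i < h, σ i = σ' i) → π h σ = π h σ')
    (n : ℕ) (τ : Fin (n + 1) → S) (s : S) :
    prefWeight M π (n + 1) (Fin.snoc (α := fun _ => S) τ s) =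
      prefWeight M π n τ * M.T (n + 1) (extSeq n τ n) (π (n + 1) (extSeq n τ)) s := by
  have hp : ∀ i < n + 1, π (i + 1) (extSeq (n + 1) (Fin.snoc (α := fun _ => S) τ s))
      = π (i + 1) (extSeq n τ) := fun i hi =>
    hπ _ _ _ fun j hj => extSeq_snoc_of_le n τ s j (by omega)
  unfold prefWeight
  rw [Finset.prod_range_succ, extSeq_snoc_last, extSeq_snoc_of_le n τ s n (by omega),
    hp n (by omega), ← mul_assoc]
  congr 2
  refine Finset.prod_congr rfl fun i hi => ?_
  have hi' := Finset.mem_range.1 hi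
  rw [hp i (by omega), extSeq_snoc_of_le n τ s i (by omega),
    extSeq_snoc_of_le n τ s (i + 1) (by omega)]

theorem sum_snoc {S : Type} [Fintype S] (n : ℕ) (f : (Fin (n + 1 + 1) → S) → ℝ) :
    ∑ τ, f τ = ∑ τ : Fin (n + 1) → S, ∑ s : S, f (Fin.snoc (α := fun _ => S) τ s) := by
  rw [← (Fin.snocEquiv (fun _ : Fin (n + 1 + 1) => S)).sum_comp, Fintype.sum_prod_type,
    Finset.sum_comm]
  rfl

/-- Per-step cost along a trajectory. -/
noncomputable def stepCost {S A : Type} [Fintype S] [Fintype A] [DecidableEq A]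
    (M : FinMDP S A) (ρ : ℕ → S → A) (π : ℕ → (ℕ → S) → A) (i : ℕ) (σ : ℕ → S) : ℝ :=
  M.R (i + 1) (σ i) (π (i + 1) σ) +
    (M.H : ℝ) * (if π (i + 1) σ ≠ ρ (i + 1) (σ i) then (1 : ℝ) else 0)

theorem val_le_pref {S A : Type} [Fintype S] [Fintype A]
    [DecidableEq S] [DecidableEq A]
    (M : FinMDP S A) (ρ : ℕ → S → A)
    (π : ℕ → (ℕ → S) → A)
    (hπ : ∀ (h : ℕ) (σ σ' : ℕ → S), (∀ i < h, σ i = σ' i) → π h σ = π h σ')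
    (n : ℕ) (hn : n ≤ M.H) :
    val M ρ 1 M.init ≤ ∑ τ : Fin (n + 1) → S, prefWeight M π n τ *
      (val M ρ (n + 1) (extSeq n τ n) +
        ∑ i ∈ Finset.range n, stepCost M ρ π i (extSeq n τ)) := by
  induction n with
  | zero =>
    refine le_of_eq ?_
    rw [Finset.sum_eq_single (fun _ => M.init)]
    · simp [prefWeight, extSeq]
    · intro τ _ hτ
      have : τ ⟨0, Nat.succ_pos 0⟩ ≠ M.init := by
        intro h
        apply hτ
        funext j
        rw [← h]
        congr 1
        exact Fin.ext (by simp)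
      unfold prefWeight
      rw [if_neg this]
      simp
    · simp
  | succ n ih =>
    refine (ih (by omega)).trans ?_
    rw [sum_snoc]
    refine Finset.sum_le_sum fun τ _ => ?_
    have hc : ∀ s : S, ∑ i ∈ Finset.range (n + 1),
        stepCost M ρ π i (extSeq (n + 1) (Fin.snoc (α := fun _ => S) τ s)) =
        ∑ i ∈ Finset.range (n + 1), stepCost M ρ π i (extSeq n τ) := by
      intro s
      refine Finset.sum_congr rfl fun i hi => ?_
      have hi' := Finset.mem_range.1 hi
      unfold stepCost
      rw [extSeq_snoc_of_le n τ s i hi', hπ (i + 1) _ (extSeq n τ)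
        fun j hj => extSeq_snoc_of_le n τ s j (by omega)]
    simp only [hc, prefWeight_snoc M π hπ, extSeq_snoc_last, mul_assoc]
    rw [← Finset.mul_sum]
    refine mul_le_mul_of_nonneg_left ?_ (prefWeight_nonneg M π n τ)
    simp only [mul_add, Finset.sum_add_distrib]
    rw [← Finset.sum_mul, M.T_sum, one_mul, Finset.sum_range_succ]
    have := val_step M ρ n (by omega) (extSeq n τ n) (π (n + 1) (extSeq n τ))
    have h2 : stepCost M ρ π n (extSeq n τ) = M.R (n + 1) (extSeq n τ n) (π (n + 1) (extSeq n τ)) +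
      (M.H : ℝ) * (if π (n + 1) (extSeq n τ) ≠ ρ (n + 1) (extSeq n τ n) then (1 : ℝ) else 0) := rfl
    linarith

/-- Performance-difference bound: for an abstract policy `ρ` and any
history-dependent policy `π` (i.e. `π h` depends only on the states `s_1,…,s_h`, encoded
as the positions `i < h` of the state sequence),
`V^ρ_M − V^π_M ≤ H · E_{M,π}[ ∑_{h=1}^H 1{a_h ≠ ρ_h(s_h)} ]`,
where the expectation is over trajectories of `π` in `M` and
`V^π_M = E_{M,π}[∑_{h=1}^H R_h(s_h, a_h)]`. -/
theorem stmt_12 {S A : Type} [Fintype S] [Fintype A] [Nonempty S] [Nonempty A]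
    [DecidableEq S] [DecidableEq A]
    (M : FinMDP S A) (ρ : ℕ → S → A)
    (π : ℕ → (ℕ → S) → A)
    (hπ : ∀ (h : ℕ) (σ σ' : ℕ → S), (∀ i < h, σ i = σ' i) → π h σ = π h σ') :
    val M ρ 1 M.init
      - (∑ τ : Fin (M.H + 1) → S, trajWeight M π τ *
          ∑ i ∈ Finset.range M.H,
            M.R (i + 1) (extSeq M.H τ i) (π (i + 1) (extSeq M.H τ)))
    ≤ (M.H : ℝ) *
        ∑ τ : Fin (M.H + 1) → S, trajWeight M π τ *
          ∑ i ∈ Finset.range M.H,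
            (if π (i + 1) (extSeq M.H τ) ≠ ρ (i + 1) (extSeq M.H τ i)
             then (1 : ℝ) else 0) := by
  have h := val_le_pref M ρ π hπ M.H le_rfl
  have h0 : ∀ s, val M ρ (M.H + 1) s = 0 := fun s => by simp [val, valAux]
  simp only [h0, zero_add, stepCost, Finset.sum_add_distrib, mul_add, ← Finset.mul_sum] at h
  rw [Finset.mul_sum, sub_le_iff_le_add']
  refine h.trans (le_of_eq ?_)
  congr 1
  refine Finset.sum_congr rfl fun τ _ => ?_
  exact mul_left_comm _ _ _
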